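/- Every equilibrium of the competitive protocol F^c is either the truthful profile (s^t,…,s^t) or a zero-information profile (s_1^r,…,s_N^r) with s_1^r,…,s_N^r ∈ S^r; i.e., any strategy profile that is neither truthful nor entirely zero-information is not an equilibrium of F^c. -/

import Mathlib

open scoped Classical
noncomputable section

/-- A strategy of an agent: `(p, q)` with `p = P(mᵢ = 0 ∣ bᵢ = 0)`, `q = P(mᵢ = 0 ∣ bᵢ = 1)`. -/
abbrev Strategy : Type := (Set.Icc (0:ℝ) 1) × (Set.Icc (0:ℝ) 1)

/-- The truthful strategy `sᵗ = (1,0)`. -/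
def sT : Strategy := (⟨1, by norm_num⟩, ⟨0, by norm_num⟩)

/-- A zero-information strategy: `p = q`. -/
def ZeroInfo (s : Strategy) : Prop := (s.1 : ℝ) = (s.2 : ℝ)

/-- Vectors of `N+1` bits (bits of the center and the `N` agents; also used for
message vectors and for the center's replies).  Coordinate `0` is the center. -/
abbrev Bits (N : ℕ) : Type := Fin (N+1) → Bool

/-- A strategy profile of the `N` agents. -/
abbrev Profile (N : ℕ) : Type := Fin N → Strategy

/-- A protocol for a single agent: a map from strategy profiles and message vectors to
distributions over replies `f ∈ {0,1}^{N+1}`. -/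
abbrev Protocol (N : ℕ) : Type := Profile N → Bits N → PMF (Bits N)

/-- `P(message = msg ∣ bit = bit)` under strategy `s` (where `false` plays the role of `0`). -/
def strandP (s : Strategy) (bit msg : Bool) : ℝ :=
  if msg then 1 - (if bit then (s.2 : ℝ) else (s.1 : ℝ))
  else (if bit then (s.2 : ℝ) else (s.1 : ℝ))

/-- `P(messages = m ∣ bits = b)` under profile `s`; the center's message is her own bit. -/
def msgP {N : ℕ} (s : Profile N) (b m : Bits N) : ℝ :=
  (if m 0 = b 0 then (1:ℝ) else 0) * ∏ i : Fin N, strandP (s i) (b i.succ) (m i.succ)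

/-- Joint probability of bits `b`, messages `m` and reply `f` (to the relevant agent),
under profile `s` and protocol `F`; bits are i.i.d. uniform. -/
def jointP {N : ℕ} (s : Profile N) (F : Protocol N) (b m f : Bits N) : ℝ :=
  ((1:ℝ)/2)^(N+1) * msgP s b m * ((F s m) f).toReal

/-- `P(bᵢ = bi, mᵢ = mi, fᵢ = f, g(b) = val)` for agent `i` (coordinate `i.succ`). -/
def pObs {N : ℕ} (g : Bits N → Bool) (s : Profile N) (F : Protocol N) (i : Fin N)
    (bi mi : Bool) (f : Bits N) (val : Bool) : ℝ :=
  ∑ b : Bits N, ∑ m : Bits N,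
    if b i.succ = bi ∧ m i.succ = mi ∧ g b = val then jointP s F b m f else 0

/-- `P(bᵢ = bi, mᵢ = mi, fᵢ = f)` for agent `i`. -/
def pObsAll {N : ℕ} (s : Profile N) (F : Protocol N) (i : Fin N)
    (bi mi : Bool) (f : Bits N) : ℝ :=
  ∑ b : Bits N, ∑ m : Bits N,
    if b i.succ = bi ∧ m i.succ = mi then jointP s F b m f else 0

/-- `P(b_k = 1, bᵢ = bi, mᵢ = mi, fᵢ = f)` for agent `i`. -/
def pBit {N : ℕ} (s : Profile N) (F : Protocol N) (i : Fin N)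
    (bi mi : Bool) (f : Bits N) (k : Fin (N+1)) : ℝ :=
  ∑ b : Bits N, ∑ m : Bits N,
    if b i.succ = bi ∧ m i.succ = mi ∧ b k = true then jointP s F b m f else 0

/-- The posterior `v_k = P(b_k = 1 ∣ fᵢ, mᵢ, bᵢ)` of agent `i` at the realization
`(bi, mi, f)`. -/
def post {N : ℕ} (s : Profile N) (F : Protocol N) (i : Fin N)
    (bi mi : Bool) (f : Bits N) (k : Fin (N+1)) : ℝ :=
  pBit s F i bi mi f k / pObsAll s F i bi mi f

/-- Expected profit `V_i(s⃗; F_i)`: after observing `(bᵢ, mᵢ, fᵢ)` the agent guesses the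
more likely value of `g(b)` (uniformly at random in case of a tie) and earns `c i` iff
the guess is correct. -/
def V {N : ℕ} (g : Bits N → Bool) (c : Fin N → ℝ) (s : Profile N) (F : Protocol N)
    (i : Fin N) : ℝ :=
  c i * ∑ bi : Bool, ∑ mi : Bool, ∑ f : Bits N,
    (if pObs g s F i bi mi f true > pObs g s F i bi mi f false then pObs g s F i bi mi f true
     else if pObs g s F i bi mi f false > pObs g s F i bi mi f true then
       pObs g s F i bi mi f false
     else (pObs g s F i bi mi f false + pObs g s F i bi mi f true) / 2)

/-- Utility `U_i(s⃗; F_i) = V_i(s⃗; F_i) − priceᵢ(sᵢ)`. -/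
def U {N : ℕ} (g : Bits N → Bool) (c : Fin N → ℝ) (price : Fin N → Strategy → ℝ)
    (s : Profile N) (F : Protocol N) (i : Fin N) : ℝ :=
  V g c s F i - price i (s i)

/-- The all-truthful profile `(sᵗ, …, sᵗ)`. -/
def truthProfile (N : ℕ) : Profile N := fun _ => sT

/-- `s⃗` is an equilibrium of the protocol `F = (F_1,…,F_N)`. -/
def Equilibrium {N : ℕ} (g : Bits N → Bool) (c : Fin N → ℝ) (price : Fin N → Strategy → ℝ)
    (s : Profile N) (FF : Fin N → Protocol N) : Prop :=
  ∀ i : Fin N, ∀ s' : Strategy,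
    U g c price s (FF i) i ≥ U g c price (Function.update s i s') (FF i) i

/-- The improvement `F_i⁺` of a protocol `F_i`: it agrees with `F_i` when `s_i` is a
zero-information strategy, and otherwise returns the reply whose first coordinate is
`m₀ = b₀` and whose remaining coordinates are those of `F_i`'s reply. -/
def improve {N : ℕ} (i : Fin N) (F : Protocol N) : Protocol N := fun s m =>
  if ZeroInfo (s i) then F s m
  else PMF.map (fun f => Function.update f 0 (m 0)) (F s m)

/-- The center is helpless. -/
def Helpless (N : ℕ) (g : Bits N → Bool) (c : Fin N → ℝ)
    (price : Fin N → Strategy → ℝ) : Prop :=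
  ∀ i : Fin N, ∀ F : Protocol N, ∀ si : Strategy, ¬ ZeroInfo si →
    ∀ sr : Profile N, (∀ j, ZeroInfo (sr j)) →
      U g c price sr F i ≥ U g c price (Function.update sr i si) (improve i F) i

/-- Relative price `price_i^r(s_i) = price_i(s_i) / price_i(sᵗ)`. -/
def priceR {N : ℕ} (price : Fin N → Strategy → ℝ) (i : Fin N) (s : Strategy) : ℝ :=
  price i s / price i sT

/-- The competitive protocol (the component `F_i^c` for agent `i`). -/
def Fc {N : ℕ} (price : Fin N → Strategy → ℝ) (i : Fin N) : Protocol N := fun s m =>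
  if ∀ j, s j = sT then PMF.pure m
  else if ∀ j, j ≠ i → priceR price j (s j) < priceR price i (s i) then PMF.pure m
  else PMF.uniformOfFintype (Bits N)

/-- The protocol that always replies the full message vector `m = (b₀, m₁, …, m_N)`. -/
def Fmax (N : ℕ) : Protocol N := fun _ m => PMF.pure m

/-- The protocol that always replies `N+1` independent uniform random bits. -/
def Fmin (N : ℕ) : Protocol N := fun _ _ => PMF.uniformOfFintype (Bits N)

/-- Agent `i` is fanatic. -/
def Fanatic {N : ℕ} (g : Bits N → Bool) (c : Fin N → ℝ) (price : Fin N → Strategy → ℝ)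
    (i : Fin N) : Prop :=
  ∀ s : Profile N,
    price i sT > V g c (truthProfile N) (Fmax N) i - V g c s (Fmin N) i

/-- The fair competitive protocol (the component `F_i^{fc}` for agent `i`). -/
def Ffc {N : ℕ} (price : Fin N → Strategy → ℝ) (i : Fin N) : Protocol N := fun s m =>
  if s i = sT then PMF.pure m
  else if (∃ j, j ≠ i ∧ s j ≠ sT) ∧
      (∀ j, j ≠ i → s j ≠ sT → priceR price j (s j) < priceR price i (s i)) then PMF.pure m
  else PMF.uniformOfFintype (Bits N)

/-- Negating the `i`-th agent's coordinate of a bit vector. -/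
def flipBit {N : ℕ} (i : Fin N) : Equiv.Perm (Bits N) :=
  Function.Involutive.toPerm (fun m => Function.update m i.succ (!m i.succ))
    (fun m => by simp)

lemma flipBit_self {N : ℕ} (i : Fin N) (m : Bits N) : flipBit i m i.succ = !m i.succ :=
  Function.update_self ..

lemma flipBit_of_ne {N : ℕ} (i : Fin N) (m : Bits N) {k : Fin (N + 1)} (h : k ≠ i.succ) :
    flipBit i m k = m k :=
  Function.update_of_ne h ..

/-- The probability of all messages except the one of agent `i`. -/
def msgPExcept {N : ℕ} (s : Profile N) (i : Fin N) (b m : Bits N) : ℝ :=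
  (if m 0 = b 0 then (1:ℝ) else 0) *
    ∏ j ∈ Finset.univ.erase i, strandP (s j) (b j.succ) (m j.succ)

lemma msgP_eq_mul_msgPExcept {N : ℕ} (s : Profile N) (i : Fin N) (b m : Bits N) :
    msgP s b m = strandP (s i) (b i.succ) (m i.succ) * msgPExcept s i b m := by
  rw [msgP, msgPExcept, ← Finset.mul_prod_erase Finset.univ _ (Finset.mem_univ i)]
  ring

lemma msgPExcept_update {N : ℕ} (s : Profile N) (i : Fin N) (t : Strategy) :
    msgPExcept (Function.update s i t) i = msgPExcept s i := by
  funext b m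
  unfold msgPExcept
  congr 1
  refine Finset.prod_congr rfl fun j hj => ?_
  rw [Function.update_of_ne (Finset.ne_of_mem_erase hj)]

lemma msgPExcept_flipBit {N : ℕ} (s : Profile N) (i : Fin N) (b m : Bits N) :
    msgPExcept s i b (flipBit i m) = msgPExcept s i b m := by
  unfold msgPExcept
  rw [flipBit_of_ne i m (Fin.succ_ne_zero i).symm]
  congr 1
  refine Finset.prod_congr rfl fun j hj => ?_
  rw [flipBit_of_ne i m fun h => Finset.ne_of_mem_erase hj (Fin.succ_injective _ h)]

lemma strandP_nonneg (s : Strategy) (b m : Bool) : 0 ≤ strandP s b m := by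
  have h₁ := s.1.2.1
  have h₂ := s.1.2.2
  have h₃ := s.2.2.1
  have h₄ := s.2.2.2
  cases b <;> cases m <;> simp [strandP] <;> assumption

lemma sum_strandP (s : Strategy) (b : Bool) : ∑ m : Bool, strandP s b m = 1 := by
  simp [strandP]

/-- The weight of agent `i`'s observation together with `g b = val`, under the reply kernel `κ`,
without the factor coming from her own strategy. -/
def obsWeight {N : ℕ} (g : Bits N → Bool) (s : Profile N) (κ : Bits N → PMF (Bits N)) (i : Fin N)
    (bi mi : Bool) (f : Bits N) (val : Bool) : ℝ :=
  ∑ b : Bits N, ∑ m : Bits N,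
    if b i.succ = bi ∧ m i.succ = mi ∧ g b = val then
      ((1:ℝ)/2)^(N+1) * msgPExcept s i b m * ((κ m) f).toReal else 0

lemma pObs_eq_mul_obsWeight {N : ℕ} (g : Bits N → Bool) (s : Profile N)
    (κ : Bits N → PMF (Bits N)) (i : Fin N) (bi mi : Bool) (f : Bits N) (val : Bool) :
    pObs g s (fun _ => κ) i bi mi f val =
      strandP (s i) bi mi * obsWeight g s κ i bi mi f val := by
  unfold pObs obsWeight
  simp only [Finset.mul_sum]
  refine Finset.sum_congr rfl fun b _ => Finset.sum_congr rfl fun m _ => ?_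
  split_ifs with h
  · rw [jointP, msgP_eq_mul_msgPExcept s i, h.1, h.2.1]
    ring
  · simp

lemma obsWeight_update {N : ℕ} (g : Bits N → Bool) (s : Profile N)
    (κ : Bits N → PMF (Bits N)) (i : Fin N) (t : Strategy) :
    obsWeight g (Function.update s i t) κ i = obsWeight g s κ i := by
  unfold obsWeight
  rw [msgPExcept_update]

lemma obsWeight_not {N : ℕ} (g : Bits N → Bool) (s : Profile N)
    {κ : Bits N → PMF (Bits N)} {i : Fin N} {e : Equiv.Perm (Bits N)}
    (hκ : ∀ m f, κ (flipBit i m) (e f) = κ m f) (bi mi : Bool) (f : Bits N) (val : Bool) :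
    obsWeight g s κ i bi (!mi) (e f) val = obsWeight g s κ i bi mi f val := by
  unfold obsWeight
  refine Finset.sum_congr rfl fun b _ => ?_
  rw [← Equiv.sum_comp (flipBit i)]
  refine Finset.sum_congr rfl fun m _ => ?_
  simp only [flipBit_self, msgPExcept_flipBit, hκ, Bool.not_inj_iff]

lemma guess_eq_max (x y : ℝ) :
    (if x > y then x else if y > x then y else (y + x) / 2) = max x y := by
  split_ifs with h₁ h₂
  · exact (max_eq_left h₁.le).symm
  · exact (max_eq_right h₂.le).symm
  · rw [le_antisymm (not_lt.1 h₁) (not_lt.1 h₂), max_self]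
    ring

/-- If negating agent `i`'s message only permutes the replies, her expected profit does not
involve her own strategy. -/
lemma V_eq_sum_obsWeight {N : ℕ} (g : Bits N → Bool) (c : Fin N → ℝ) (s : Profile N)
    {κ : Bits N → PMF (Bits N)} {i : Fin N} {e : Equiv.Perm (Bits N)}
    (hκ : ∀ m f, κ (flipBit i m) (e f) = κ m f) :
    V g c s (fun _ => κ) i = c i * ∑ bi : Bool, ∑ f : Bits N,
      max (obsWeight g s κ i bi true f true) (obsWeight g s κ i bi true f false) := by
  have hmi : ∀ bi mi, ∑ f : Bits N,
      max (obsWeight g s κ i bi mi f true) (obsWeight g s κ i bi mi f false) =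
      ∑ f : Bits N,
        max (obsWeight g s κ i bi true f true) (obsWeight g s κ i bi true f false) := by
    rintro bi (_ | _)
    · rw [← Equiv.sum_comp e]
      exact Finset.sum_congr rfl fun f _ => by
        rw [← obsWeight_not g s hκ bi true, ← obsWeight_not g s hκ bi true, Bool.not_true]
    · rfl
  unfold V
  simp only [guess_eq_max, pObs_eq_mul_obsWeight, ← mul_max_of_nonneg _ _ (strandP_nonneg _ _ _),
    ← Finset.mul_sum, hmi, ← Finset.sum_mul, sum_strandP, one_mul]

lemma V_update_of_flip_invariant {N : ℕ} (g : Bits N → Bool) (c : Fin N → ℝ) (s : Profile N)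
    {κ : Bits N → PMF (Bits N)} {i : Fin N} {e : Equiv.Perm (Bits N)}
    (hκ : ∀ m f, κ (flipBit i m) (e f) = κ m f) (t : Strategy) :
    V g c (Function.update s i t) (fun _ => κ) i = V g c s (fun _ => κ) i := by
  rw [V_eq_sum_obsWeight g c _ hκ, V_eq_sum_obsWeight g c _ hκ, obsWeight_update]

lemma V_Fmax_update {N : ℕ} (g : Bits N → Bool) (c : Fin N → ℝ) (s : Profile N) (i : Fin N)
    (t : Strategy) : V g c (Function.update s i t) (Fmax N) i = V g c s (Fmax N) i :=
  V_update_of_flip_invariant g c s (κ := PMF.pure) (e := flipBit i)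
    (fun m f => by simp [PMF.pure_apply]) t

lemma V_Fmin_update {N : ℕ} (g : Bits N → Bool) (c : Fin N → ℝ) (s : Profile N) (i : Fin N)
    (t : Strategy) : V g c (Function.update s i t) (Fmin N) i = V g c s (Fmin N) i :=
  V_update_of_flip_invariant g c s (κ := fun _ => PMF.uniformOfFintype (Bits N))
    (e := Equiv.refl _) (fun m f => by simp) t

lemma V_congr {N : ℕ} (g : Bits N → Bool) (c : Fin N → ℝ) {s : Profile N} {F G : Protocol N}
    (h : F s = G s) (i : Fin N) : V g c s F i = V g c s G i := by
  have hObs : pObs g s F = pObs g s G := by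
    funext i bi mi f val
    unfold pObs jointP
    rw [h]
  simp only [V, hObs]

lemma Fc_eq_Fmax {N : ℕ} {price : Fin N → Strategy → ℝ} {i : Fin N} {s : Profile N}
    (h : ∀ j, j ≠ i → priceR price j (s j) < priceR price i (s i)) :
    Fc price i s = Fmax N s := by
  funext m
  simp only [Fc, Fmax, if_pos h, ite_self]

lemma Fc_eq_Fmin {N : ℕ} {price : Fin N → Strategy → ℝ} {i : Fin N} {s : Profile N}
    (ht : ¬ ∀ j, s j = sT)
    (h : ¬ ∀ j, j ≠ i → priceR price j (s j) < priceR price i (s i)) :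
    Fc price i s = Fmin N s := by
  funext m
  simp only [Fc, Fmin, if_neg h, if_neg ht]

lemma not_zeroInfo_sT : ¬ ZeroInfo sT := by
  simp [ZeroInfo, sT]

lemma zeroInfo_diag (p : Set.Icc (0:ℝ) 1) : ZeroInfo (p, p) := rfl

instance : PreconnectedSpace (Set.Icc (0:ℝ) 1) :=
  Subtype.preconnectedSpace isPreconnected_Icc

/-- A strategy of positive price can be made strictly cheaper while its relative price stays above
finitely many smaller bounds. -/
lemma exists_cheaper_strategy {ι : Type*} [Finite ι] {pr : Strategy → ℝ} (hcont : Continuous pr)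
    (hzero : ∀ t, ZeroInfo t → pr t = 0) {t : Strategy} (ht : 0 < pr t) {r : ι → ℝ}
    (hr : ∀ j, r j < pr t) : ∃ t', pr t' < pr t ∧ ∀ j, r j < pr t' := by
  have hr' : ∀ᶠ v in nhdsWithin (pr t) (Set.Iio (pr t)), ∀ j, r j < v :=
    Filter.eventually_all.2 fun j =>
      Filter.Eventually.filter_mono nhdsWithin_le_nhds (lt_mem_nhds (hr j))
  have hpos : ∀ᶠ v in nhdsWithin (pr t) (Set.Iio (pr t)), 0 < v :=
    Filter.Eventually.filter_mono nhdsWithin_le_nhds (lt_mem_nhds ht)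
  obtain ⟨v, hrv, hv, hvt⟩ := (hr'.and (hpos.and self_mem_nhdsWithin)).exists
  obtain ⟨t', rfl⟩ := intermediate_value_univ (t.1, t.1) t hcont
    ⟨(hzero _ (zeroInfo_diag _)).trans_le hv.le, le_of_lt hvt⟩
  exact ⟨t', hvt, hrv⟩

/-- the competitive protocol has only truthful or zero-information
equilibria. -/
theorem Fc_equilibria_dichotomy (N : ℕ) (hN : 2 ≤ N) (g : Bits N → Bool) (c : Fin N → ℝ)
    (hc : ∀ i, 0 < c i)
    (price : Fin N → Strategy → ℝ)
    (hpriceCont : ∀ i, Continuous (price i))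
    (hprice0 : ∀ i s, ZeroInfo s → price i s = 0)
    (hpricePos : ∀ i s, ¬ ZeroInfo s → 0 < price i s)
    (hpriceMax : ∀ i s, price i s ≤ price i sT)
    (s : Profile N) (hs : Equilibrium g c price s (Fc price)) :
    s = truthProfile N ∨ ∀ j, ZeroInfo (s j) := by
  by_contra! hcon
  obtain ⟨hnt, k, hk⟩ := hcon
  have hnt' : ¬ ∀ j, s j = sT := fun h => hnt (funext h)
  have hT : ∀ i, 0 < price i sT := fun i => hpricePos i _ not_zeroInfo_sT
  obtain ⟨i, -, hi⟩ := Finset.exists_max_image Finset.univ (fun j => priceR price j (s j))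
    ⟨k, Finset.mem_univ k⟩
  have hpi : 0 < price i (s i) := by
    have : 0 < priceR price i (s i) :=
      (div_pos (hpricePos k _ hk) (hT k)).trans_le (hi k (Finset.mem_univ k))
    exact (div_pos_iff_of_pos_right (hT i)).1 this
  by_cases hstrict : ∀ j, j ≠ i → priceR price j (s j) < priceR price i (s i)
  · obtain ⟨t, ht, hrt⟩ := exists_cheaper_strategy (ι := {j // j ≠ i}) (hpriceCont i)
      (hprice0 i) hpi (r := fun j => priceR price j (s j) * price i sT)
      (fun j => (lt_div_iff₀ (hT i)).1 (hstrict j j.2))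
    have hstrict' : ∀ j, j ≠ i → priceR price j (Function.update s i t j) <
        priceR price i (Function.update s i t i) := by
      intro j hj
      rw [Function.update_self, Function.update_of_ne hj]
      exact (lt_div_iff₀ (hT i)).2 (hrt ⟨j, hj⟩)
    have := hs i t
    rw [U, U, V_congr g c (Fc_eq_Fmax hstrict), V_congr g c (Fc_eq_Fmax hstrict'),
      V_Fmax_update, Function.update_self] at this
    linarith
  · have hz := zeroInfo_diag (s i).1
    set t : Strategy := ((s i).1, (s i).1)
    obtain ⟨j, hj, hji⟩ : ∃ j, j ≠ i ∧ priceR price i (s i) ≤ priceR price j (s j) := by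
      simpa using hstrict
    have hnt'' : ¬ ∀ j, Function.update s i t j = sT := fun h =>
      not_zeroInfo_sT (h i ▸ (Function.update_self i t s).symm ▸ hz)
    have hstrict' : ¬ ∀ j, j ≠ i → priceR price j (Function.update s i t j) <
        priceR price i (Function.update s i t i) := by
      intro h
      have h := h j hj
      rw [Function.update_self, Function.update_of_ne hj] at h
      have h0 : priceR price i t = 0 := by rw [priceR, hprice0 i t hz, zero_div]
      linarith [div_pos hpi (hT i), show priceR price i (s i) = price i (s i) / price i sT from rfl]
    have := hs i t
    rw [U, U, V_congr g c (Fc_eq_Fmin hnt' hstrict), V_congr g c (Fc_eq_Fmin hnt'' hstrict'),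
      V_Fmin_update, Function.update_self, hprice0 i t hz] at this
    linarith

end
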